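/- arXiv:1910.11199 — 3 statements merged into one kernel-verified Lean document; each statement's English description precedes it below -/
import Mathlib

section
/- Let f be Lipschitz continuous of rank L on an open neighborhood of the closed ball B̄_ε(x), where x ∈ X and ε > 0. Then ∂^ε f(x) = {a ∈ X : ⟨a,h⟩ ≤ f⁰_ε(x;h) for all h ∈ X}. -/
open Filter Metric Set Topology MeasureTheory
open scoped RealInnerProductSpace NNReal

variable {X : Type*} [NormedAddCommGroup X] [InnerProductSpace ℝ X] [CompleteSpace X]

/-- Clarke's generalized directional derivative. -/
noncomputable def clarkeDeriv (f : X → ℝ) (x h : X) : ℝ :=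
  Filter.limsup (fun p : X × ℝ => (f (p.1 + p.2 • h) - f p.1) / p.2)
    ((𝓝 x) ×ˢ (𝓝[>] (0:ℝ)))

/-- Clarke's generalized gradient. -/
noncomputable def clarkeGrad (f : X → ℝ) (x : X) : Set X :=
  {a | ∀ h : X, ⟪a, h⟫ ≤ clarkeDeriv f x h}

/-- The gradient of `f` on the closed ball of radius `ε` about `x`. -/
noncomputable def epsGrad (f : X → ℝ) (ε : ℝ) (x : X) : Set X :=
  closure (convexHull ℝ (⋃ y ∈ Metric.closedBall x ε, clarkeGrad f y))

/-- The directional derivative of `f` on the closed ball of radius `ε` about `x`. -/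
noncomputable def epsDeriv (f : X → ℝ) (ε : ℝ) (x h : X) : ℝ :=
  sSup ((fun y => clarkeDeriv f y h) '' Metric.closedBall x ε)

omit [CompleteSpace X] in
theorem tendsto_add_smul_prod_nhdsGT (x h : X) :
    Tendsto (fun p : X × ℝ => (p.1 + p.2 • h, p.2)) ((𝓝 x) ×ˢ (𝓝[>] (0:ℝ)))
      ((𝓝 x) ×ˢ (𝓝[>] (0:ℝ))) := by
  refine Tendsto.prodMk ?_ tendsto_snd
  have hc : Tendsto (fun p : X × ℝ => p.1 + p.2 • h) (𝓝 (x, 0)) (𝓝 x) := by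
    have : Continuous fun p : X × ℝ => p.1 + p.2 • h := by fun_prop
    simpa using this.tendsto (x, 0)
  refine hc.mono_left ?_
  rw [nhds_prod_eq]
  exact Filter.prod_mono le_rfl nhdsWithin_le_nhds

omit [InnerProductSpace ℝ X] [CompleteSpace X] in
theorem eventually_snd_pos (x : X) :
    ∀ᶠ p : X × ℝ in (𝓝 x) ×ˢ (𝓝[>] (0:ℝ)), 0 < p.2 :=
  tendsto_snd.eventually self_mem_nhdsWithin

omit [CompleteSpace X] in
theorem eventually_abs_diffQuot_le {f : X → ℝ} {x : X} {L : ℝ≥0} {U : Set X} (hU : U ∈ 𝓝 x)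
    (hf : LipschitzOnWith L f U) (h : X) :
    ∀ᶠ p : X × ℝ in (𝓝 x) ×ˢ (𝓝[>] (0:ℝ)),
      |(f (p.1 + p.2 • h) - f p.1) / p.2| ≤ L * ‖h‖ := by
  have h₁ : ∀ᶠ p : X × ℝ in (𝓝 x) ×ˢ (𝓝[>] (0:ℝ)), p.1 ∈ U := tendsto_fst.eventually hU
  have h₂ : ∀ᶠ p : X × ℝ in (𝓝 x) ×ˢ (𝓝[>] (0:ℝ)), p.1 + p.2 • h ∈ U :=
    (tendsto_add_smul_prod_nhdsGT x h).eventually h₁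
  filter_upwards [h₁, h₂, eventually_snd_pos x] with p hp₁ hp₂ hp
  have := hf.dist_le_mul _ hp₂ _ hp₁
  rw [Real.dist_eq, dist_eq_norm, add_sub_cancel_left, norm_smul, Real.norm_eq_abs,
    abs_of_pos hp] at this
  rw [abs_div, abs_of_pos hp, div_le_iff₀ hp]
  linarith

omit [CompleteSpace X] in
theorem clarkeDeriv_le_of_eventually_le {f : X → ℝ} {x : X} {L : ℝ≥0} {U : Set X} (hU : U ∈ 𝓝 x)
    (hf : LipschitzOnWith L f U) {h : X} {c : ℝ}
    (hc : ∀ᶠ p : X × ℝ in (𝓝 x) ×ˢ (𝓝[>] (0:ℝ)), (f (p.1 + p.2 • h) - f p.1) / p.2 ≤ c) :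
    clarkeDeriv f x h ≤ c := by
  have hb : IsBoundedUnder (· ≥ ·) ((𝓝 x) ×ˢ (𝓝[>] (0:ℝ)))
      (fun p : X × ℝ => (f (p.1 + p.2 • h) - f p.1) / p.2) :=
    isBoundedUnder_of_eventually_ge
      ((eventually_abs_diffQuot_le hU hf h).mono fun _ hp => (abs_le.1 hp).1)
  exact limsup_le_of_le hb.isCoboundedUnder_le hc

omit [CompleteSpace X] in
theorem eventually_lt_of_clarkeDeriv_lt {f : X → ℝ} {x : X} {L : ℝ≥0} {U : Set X} (hU : U ∈ 𝓝 x)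
    (hf : LipschitzOnWith L f U) {h : X} {c : ℝ} (hc : clarkeDeriv f x h < c) :
    ∀ᶠ p : X × ℝ in (𝓝 x) ×ˢ (𝓝[>] (0:ℝ)), (f (p.1 + p.2 • h) - f p.1) / p.2 < c :=
  eventually_lt_of_limsup_lt hc <| isBoundedUnder_of_eventually_le
    ((eventually_abs_diffQuot_le hU hf h).mono fun _ hp => (abs_le.1 hp).2)

omit [CompleteSpace X] in
theorem clarkeDeriv_le {f : X → ℝ} {x : X} {L : ℝ≥0} {U : Set X} (hU : U ∈ 𝓝 x)
    (hf : LipschitzOnWith L f U) (h : X) : clarkeDeriv f x h ≤ L * ‖h‖ :=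
  clarkeDeriv_le_of_eventually_le hU hf
    ((eventually_abs_diffQuot_le hU hf h).mono fun _ hp => (abs_le.1 hp).2)

omit [CompleteSpace X] in
theorem clarkeDeriv_zero (f : X → ℝ) (x : X) : clarkeDeriv f x 0 = 0 := by
  simp [clarkeDeriv]

omit [CompleteSpace X] in
theorem clarkeDeriv_add_le {f : X → ℝ} {x : X} {L : ℝ≥0} {U : Set X} (hU : U ∈ 𝓝 x)
    (hf : LipschitzOnWith L f U) (h k : X) :
    clarkeDeriv f x (h + k) ≤ clarkeDeriv f x h + clarkeDeriv f x k := by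
  refine le_of_forall_pos_le_add fun δ hδ => clarkeDeriv_le_of_eventually_le hU hf ?_
  have h₁ := eventually_lt_of_clarkeDeriv_lt hU hf
    (show clarkeDeriv f x h < clarkeDeriv f x h + δ / 2 by linarith)
  have h₂ := (tendsto_add_smul_prod_nhdsGT x h).eventually
    (eventually_lt_of_clarkeDeriv_lt hU hf
      (show clarkeDeriv f x k < clarkeDeriv f x k + δ / 2 by linarith))
  filter_upwards [h₁, h₂] with p hp₁ hp₂
  have : (f (p.1 + p.2 • (h + k)) - f p.1) / p.2 =
      (f (p.1 + p.2 • h + p.2 • k) - f (p.1 + p.2 • h)) / p.2 +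
        (f (p.1 + p.2 • h) - f p.1) / p.2 := by
    rw [smul_add, ← add_assoc]; ring
  linarith

omit [CompleteSpace X] in
theorem clarkeDeriv_smul_le {f : X → ℝ} {x : X} {L : ℝ≥0} {U : Set X} (hU : U ∈ 𝓝 x)
    (hf : LipschitzOnWith L f U) {c : ℝ} (hc : 0 < c) (h : X) :
    clarkeDeriv f x (c • h) ≤ c * clarkeDeriv f x h := by
  refine le_of_forall_pos_le_add fun δ hδ => clarkeDeriv_le_of_eventually_le hU hf ?_
  have hlt : clarkeDeriv f x h < clarkeDeriv f x h + δ / c := by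
    have := div_pos hδ hc
    linarith
  have hmul : Tendsto (fun t : ℝ => t * c) (𝓝[>] 0) (𝓝[>] 0) := by
    refine tendsto_nhdsWithin_iff.2 ⟨?_, ?_⟩
    · have : Continuous fun t : ℝ => t * c := by fun_prop
      simpa using (this.tendsto 0).mono_left nhdsWithin_le_nhds
    · filter_upwards [self_mem_nhdsWithin] with t ht
      exact mul_pos ht hc
  have hev := (tendsto_id.prodMap hmul).eventually (eventually_lt_of_clarkeDeriv_lt hU hf hlt)
  filter_upwards [hev, eventually_snd_pos x] with p hp hpos
  simp only [Prod.map, id] at hp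
  have : (f (p.1 + p.2 • c • h) - f p.1) / p.2 =
      c * ((f (p.1 + (p.2 * c) • h) - f p.1) / (p.2 * c)) := by
    rw [smul_smul]; field_simp
  rw [this]
  calc _ ≤ c * (clarkeDeriv f x h + δ / c) := by gcongr
    _ = _ := by field_simp

omit [CompleteSpace X] in
theorem clarkeDeriv_smul {f : X → ℝ} {x : X} {L : ℝ≥0} {U : Set X} (hU : U ∈ 𝓝 x)
    (hf : LipschitzOnWith L f U) {c : ℝ} (hc : 0 < c) (h : X) :
    clarkeDeriv f x (c • h) = c * clarkeDeriv f x h := by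
  refine le_antisymm (clarkeDeriv_smul_le hU hf hc h) ?_
  have := clarkeDeriv_smul_le hU hf (inv_pos.2 hc) (c • h)
  rw [inv_smul_smul₀ hc.ne'] at this
  rwa [← le_inv_mul_iff₀ hc]

omit [CompleteSpace X] in
theorem mul_clarkeDeriv_le_clarkeDeriv_smul {f : X → ℝ} {x : X} {L : ℝ≥0} {U : Set X}
    (hU : U ∈ 𝓝 x) (hf : LipschitzOnWith L f U) (c : ℝ) (h : X) :
    c * clarkeDeriv f x h ≤ clarkeDeriv f x (c • h) := by
  rcases lt_trichotomy c 0 with hc | rfl | hc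
  · have h₁ := clarkeDeriv_add_le hU hf (c • h) ((-c) • h)
    rw [← add_smul, add_neg_cancel, zero_smul, clarkeDeriv_zero,
      clarkeDeriv_smul hU hf (neg_pos.2 hc)] at h₁
    linarith
  · simp [clarkeDeriv_zero]
  · exact (clarkeDeriv_smul hU hf hc h).ge

/-- The Clarke derivative is the support function of the Clarke gradient, and the supremum is
attained. -/
theorem exists_mem_clarkeGrad_inner_eq {f : X → ℝ} {x : X} {L : ℝ≥0} {U : Set X} (hU : U ∈ 𝓝 x)
    (hf : LipschitzOnWith L f U) (h : X) :
    ∃ b ∈ clarkeGrad f x, ⟪b, h⟫ = clarkeDeriv f x h := by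
  have hwd : ∀ c : ℝ, c • h = 0 → c • clarkeDeriv f x h = 0 := fun c hc => by
    rcases smul_eq_zero.1 hc with rfl | rfl
    · simp
    · simp [clarkeDeriv_zero]
  obtain ⟨g, hg, hle⟩ := exists_extension_of_le_sublinear
    (LinearPMap.mkSpanSingleton' h (clarkeDeriv f x h) hwd) (clarkeDeriv f x)
    (fun c hc k => clarkeDeriv_smul hU hf hc k) (clarkeDeriv_add_le hU hf) (by
      rintro ⟨k, hk⟩
      obtain ⟨c, rfl⟩ := Submodule.mem_span_singleton.1 hk
      rw [LinearPMap.mkSpanSingleton'_apply]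
      exact mul_clarkeDeriv_le_clarkeDeriv_smul hU hf c h)
  have hbound : ∀ k, ‖g k‖ ≤ L * ‖k‖ := fun k => by
    have h₁ := (hle k).trans (clarkeDeriv_le hU hf k)
    have h₂ := (hle (-k)).trans (clarkeDeriv_le hU hf (-k))
    rw [map_neg, norm_neg] at h₂
    exact abs_le.2 ⟨by linarith, h₁⟩
  refine ⟨(InnerProductSpace.toDual ℝ X).symm (g.mkContinuous L hbound), fun k => ?_, ?_⟩
  · simpa using hle k
  · have hgh := hg ⟨h, Submodule.mem_span_singleton_self h⟩
    have hv := LinearPMap.mkSpanSingleton'_apply_self (σ := RingHom.id ℝ) h (clarkeDeriv f x h) hwd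
      (Submodule.mem_span_singleton_self h)
    rw [hv] at hgh
    simpa using hgh

/-- Proposition 2.1(3): characterization of `∂^ε f(x)` via `f⁰_ε(x;·)`. -/
theorem epsGrad_eq_setOf_le_epsDeriv
    (f : X → ℝ) (x : X) (ε : ℝ) (hε : 0 < ε) (L : ℝ≥0) (U : Set X)
    (hU : IsOpen U) (hBU : Metric.closedBall x ε ⊆ U)
    (hf : LipschitzOnWith L f U) :
    epsGrad f ε x = {a : X | ∀ h : X, ⟪a, h⟫ ≤ epsDeriv f ε x h} := by
  have hUn : ∀ y ∈ closedBall x ε, U ∈ 𝓝 y := fun y hy => hU.mem_nhds (hBU hy)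
  apply Subset.antisymm
  · refine closure_minimal (convexHull_min ?_ ?_) ?_
    · refine iUnion₂_subset fun y hy a ha h => (ha h).trans (le_csSup ?_ (mem_image_of_mem _ hy))
      refine ⟨L * ‖h‖, ?_⟩
      rintro _ ⟨z, hz, rfl⟩
      exact clarkeDeriv_le (hUn z hz) hf h
    · rw [ofPred_forall]
      refine convex_iInter fun h => convex_halfSpace_le (f := fun a : X => ⟪a, h⟫) ?_ _
      exact ⟨fun a b => inner_add_left a b h, fun c a => real_inner_smul_left a h c⟩
    · rw [ofPred_forall]
      exact isClosed_iInter fun h => isClosed_le (by fun_prop) continuous_const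
  · intro a ha
    by_contra hna
    obtain ⟨g, u, hgu, hua⟩ :=
      geometric_hahn_banach_closed_point (convex_convexHull ℝ _).closure isClosed_closure hna
    set h := (InnerProductSpace.toDual ℝ X).symm g with hh
    have hg : ∀ b, g b = ⟪b, h⟫ := fun b => by
      rw [real_inner_comm, hh, InnerProductSpace.toDual_symm_apply]
    have hle : epsDeriv f ε x h ≤ u := by
      refine csSup_le ((nonempty_closedBall.2 hε.le).image _) ?_
      rintro _ ⟨y, hy, rfl⟩
      obtain ⟨b, hb, hbh⟩ := exists_mem_clarkeGrad_inner_eq (hUn y hy) hf h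
      have := hgu b (subset_closure (subset_convexHull ℝ _ (mem_biUnion hy hb)))
      rw [hg, hbh] at this
      exact this.le
    have := ha h
    rw [hg] at hua
    linarith
end

section
/- Let f be Lipschitz continuous of rank L on an open neighborhood of the closed ball B̄_ε(x), where x ∈ X and ε > 0. Let h ∈ X with f⁰_ε(x;h) < 0 and let t > 0 be such that the open segment {x + s·h : 0 < s < t} is contained in B̄_ε(x). Then f(x + t·h) ≤ f(x) + t·f⁰_ε(x;h) < f(x). -/
open Filter Metric Set Topology MeasureTheory
open scoped RealInnerProductSpace NNReal

variable {X : Type*} [NormedAddCommGroup X] [InnerProductSpace ℝ X] [CompleteSpace X]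

/-- Near a point of an open set on which `f` is `L`-Lipschitz, the difference quotients of `f` in
direction `h` are bounded by `L * ‖h‖`. -/
lemma eventually_abs_quotient_le {E : Type*} [NormedAddCommGroup E] [NormedSpace ℝ E]
    {f : E → ℝ} {L : ℝ≥0} {U : Set E} (hU : IsOpen U) (hf : LipschitzOnWith L f U)
    {y : E} (hy : y ∈ U) (h : E) :
    ∀ᶠ p : E × ℝ in (𝓝 y) ×ˢ (𝓝[>] (0:ℝ)),
      |(f (p.1 + p.2 • h) - f p.1) / p.2| ≤ L * ‖h‖ := by
  have hle : (𝓝 y) ×ˢ (𝓝[>] (0:ℝ)) ≤ 𝓝 (y, (0:ℝ)) := by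
    rw [nhds_prod_eq]
    exact Filter.prod_mono le_rfl nhdsWithin_le_nhds
  have hcont : Continuous fun p : E × ℝ => p.1 + p.2 • h := by fun_prop
  have hbase : ∀ᶠ p : E × ℝ in 𝓝 (y, (0:ℝ)), p.1 ∈ U :=
    continuous_fst.continuousAt.eventually_mem (hU.mem_nhds hy)
  have hmove : ∀ᶠ p : E × ℝ in 𝓝 (y, (0:ℝ)), p.1 + p.2 • h ∈ U :=
    hcont.continuousAt.eventually_mem (hU.mem_nhds (by simpa using hy))
  have hpos : ∀ᶠ p : E × ℝ in (𝓝 y) ×ˢ (𝓝[>] (0:ℝ)), 0 < p.2 :=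
    tendsto_snd.eventually self_mem_nhdsWithin
  filter_upwards [hle hbase, hle hmove, hpos] with p hp₁ hp₂ hp₃
  have hp₁ : p.1 ∈ U := hp₁
  have hp₂ : p.1 + p.2 • h ∈ U := hp₂
  rw [abs_div, abs_of_pos hp₃, div_le_iff₀ hp₃]
  have hdist := hf.dist_le_mul _ hp₂ _ hp₁
  rw [Real.dist_eq, dist_eq_norm, add_sub_cancel_left, norm_smul, Real.norm_eq_abs,
    abs_of_pos hp₃] at hdist
  linarith

section ClarkeDerivative

variable {E : Type*} [NormedAddCommGroup E] [InnerProductSpace ℝ E]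
  {f : E → ℝ} {L : ℝ≥0} {U : Set E}

lemma clarkeDeriv_le_of_lipschitzOnWith (hU : IsOpen U) (hf : LipschitzOnWith L f U)
    {y : E} (hy : y ∈ U) (h : E) : clarkeDeriv f y h ≤ L * ‖h‖ := by
  have hb := eventually_abs_quotient_le hU hf hy h
  have hlow : IsBoundedUnder (· ≥ ·) ((𝓝 y) ×ˢ (𝓝[>] (0:ℝ)))
      (fun p : E × ℝ => (f (p.1 + p.2 • h) - f p.1) / p.2) :=
    ⟨-(L * ‖h‖), eventually_map.2 <| hb.mono fun p hp => (abs_le.1 hp).1⟩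
  exact limsup_le_of_le hlow.isCoboundedUnder_le (hb.mono fun p hp => (abs_le.1 hp).2)

lemma clarkeDeriv_le_epsDeriv (hU : IsOpen U) (hf : LipschitzOnWith L f U) {x : E} {ε : ℝ}
    (hBU : Metric.closedBall x ε ⊆ U) (h : E) {y : E} (hy : y ∈ Metric.closedBall x ε) :
    clarkeDeriv f y h ≤ epsDeriv f ε x h := by
  refine le_csSup ⟨L * ‖h‖, ?_⟩ (mem_image_of_mem _ hy)
  rintro _ ⟨z, hz, rfl⟩
  exact clarkeDeriv_le_of_lipschitzOnWith hU hf (hBU hz) h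

/-- Along a line, the right slopes of `f` are eventually below any number exceeding the Clarke
derivative. -/
lemma eventually_slope_lt_of_clarkeDeriv_lt (hU : IsOpen U) (hf : LipschitzOnWith L f U)
    {x h : E} {s r : ℝ} (hs : x + s • h ∈ U) (hr : clarkeDeriv f (x + s • h) h < r) :
    ∀ᶠ z in 𝓝[>] s, slope (fun u : ℝ => f (x + u • h)) s z < r := by
  have hb := eventually_abs_quotient_le hU hf hs h
  have hup : IsBoundedUnder (· ≤ ·) ((𝓝 (x + s • h)) ×ˢ (𝓝[>] (0:ℝ)))
      (fun p : E × ℝ => (f (p.1 + p.2 • h) - f p.1) / p.2) :=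
    ⟨L * ‖h‖, eventually_map.2 <| hb.mono fun p hp => (abs_le.1 hp).2⟩
  have hlt := eventually_lt_of_limsup_lt hr hup
  have hsub : Tendsto (fun z : ℝ => z - s) (𝓝[>] s) (𝓝[>] 0) := by
    refine tendsto_nhdsWithin_iff.2 ⟨?_, ?_⟩
    · have : Tendsto (fun z : ℝ => z - s) (𝓝 s) (𝓝 (s - s)) :=
        (continuous_id.sub continuous_const).tendsto s
      rw [sub_self] at this
      exact this.mono_left nhdsWithin_le_nhds
    · filter_upwards [self_mem_nhdsWithin] with z hz
      exact sub_pos.2 (mem_Ioi.1 hz)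
  have hpair : Tendsto (fun z : ℝ => (x + s • h, z - s)) (𝓝[>] s)
      ((𝓝 (x + s • h)) ×ˢ (𝓝[>] (0:ℝ))) :=
    Tendsto.prodMk tendsto_const_nhds hsub
  filter_upwards [hpair.eventually hlt] with z hz
  have hz' : x + s • h + (z - s) • h = x + z • h := by
    rw [add_assoc, ← add_smul, add_sub_cancel]
  rw [slope_def_field]
  simpa only [hz'] using hz

end ClarkeDerivative

/-- Proposition 2.1(4): descent along a direction with negative `f⁰_ε(x;h)`. -/
theorem descent_of_epsDeriv_neg
    (f : X → ℝ) (x : X) (ε : ℝ) (hε : 0 < ε) (L : ℝ≥0) (U : Set X)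
    (hU : IsOpen U) (hBU : Metric.closedBall x ε ⊆ U)
    (hf : LipschitzOnWith L f U)
    (h : X) (hneg : epsDeriv f ε x h < 0)
    (t : ℝ) (ht : 0 < t)
    (hseg : ∀ s : ℝ, 0 < s → s < t → x + s • h ∈ Metric.closedBall x ε) :
    f (x + t • h) ≤ f x + t * epsDeriv f ε x h ∧ f x + t * epsDeriv f ε x h < f x := by
  refine ⟨?_, by linarith [mul_neg_of_pos_of_neg ht hneg]⟩
  have hline : Continuous fun s : ℝ => x + s • h := by fun_prop
  have hmem : ∀ s ∈ Icc 0 t, x + s • h ∈ Metric.closedBall x ε := by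
    have hsub : Ioo 0 t ⊆ (fun s : ℝ => x + s • h) ⁻¹' Metric.closedBall x ε :=
      fun s hs => hseg s hs.1 hs.2
    have hcl := closure_minimal hsub (Metric.isClosed_closedBall.preimage hline)
    rw [closure_Ioo ht.ne] at hcl
    exact hcl
  have hcont : ContinuousOn (fun s : ℝ => f (x + s • h)) (Icc 0 t) :=
    hf.continuousOn.comp hline.continuousOn fun s hs => hBU (hmem s hs)
  have hB : ∀ s : ℝ, HasDerivAt (fun s => f x + s * epsDeriv f ε x h) (epsDeriv f ε x h) s :=
    fun s => by simpa using ((hasDerivAt_id s).mul_const (epsDeriv f ε x h)).const_add (f x)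
  refine image_le_of_liminf_slope_right_le_deriv_boundary hcont (by simp)
    (fun s _ => (hB s).continuousAt.continuousWithinAt) (fun s _ => (hB s).hasDerivWithinAt)
    (fun s hs r hr => ?_) (right_mem_Icc.2 ht.le)
  have hs' := hmem s (Ico_subset_Icc_self hs)
  exact (eventually_slope_lt_of_clarkeDeriv_lt hU hf (hBU hs')
    ((clarkeDeriv_le_epsDeriv hU hf hBU h hs').trans_lt hr)).frequently
end

section
/- Let f be locally Lipschitz continuous, let x ∈ X, and let (ε_k) be a sequence of positive reals with ε_k → 0. Then for every h ∈ X one has lim_{k→∞} f⁰_{ε_k}(x;h) = f⁰(x;h), and ⋂_{k∈ℕ} ∂^{ε_k} f(x) = ∂f(x). -/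
open Filter Metric Set Topology MeasureTheory
open scoped RealInnerProductSpace NNReal

variable {X : Type*} [NormedAddCommGroup X] [InnerProductSpace ℝ X] [CompleteSpace X]

/-- Difference quotients of a locally Lipschitz function are locally bounded. -/
lemma LocallyLipschitz.eventually_abs_quotient_le {f : X → ℝ} (hf : LocallyLipschitz f)
    (x h : X) : ∃ C : ℝ, ∀ᶠ p : X × ℝ in (𝓝 x) ×ˢ (𝓝[>] (0:ℝ)),
      |(f (p.1 + p.2 • h) - f p.1) / p.2| ≤ C := by
  obtain ⟨K, t, ht, hK⟩ := hf x
  have h1 : Tendsto (fun p : X × ℝ => p.1) ((𝓝 x) ×ˢ (𝓝[>] (0:ℝ))) (𝓝 x) := tendsto_fst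
  have h2 : Tendsto (fun p : X × ℝ => p.2) ((𝓝 x) ×ˢ (𝓝[>] (0:ℝ))) (𝓝[>] 0) := tendsto_snd
  have h3 : Tendsto (fun p : X × ℝ => p.1 + p.2 • h) ((𝓝 x) ×ˢ (𝓝[>] (0:ℝ))) (𝓝 x) := by
    simpa using h1.add ((h2.mono_right nhdsWithin_le_nhds).smul_const h)
  refine ⟨K * ‖h‖, ?_⟩
  filter_upwards [h1 ht, h3 ht, h2 self_mem_nhdsWithin] with p hp1 hp3 hp2
  have hpos : 0 < p.2 := hp2
  have hd := hK.dist_le_mul _ hp3 _ hp1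
  rw [Real.dist_eq, dist_eq_norm, add_sub_cancel_left, norm_smul, Real.norm_of_nonneg hpos.le]
    at hd
  rw [abs_div, abs_of_pos hpos, div_le_iff₀ hpos]
  linarith

/-- The Clarke derivative is upper semicontinuous in the base point. -/
lemma LocallyLipschitz.eventually_clarkeDeriv_le {f : X → ℝ} (hf : LocallyLipschitz f)
    {x h : X} {c : ℝ} (hc : clarkeDeriv f x h < c) : ∀ᶠ y in 𝓝 x, clarkeDeriv f y h ≤ c := by
  obtain ⟨C, hC⟩ := hf.eventually_abs_quotient_le x h
  have hlt := eventually_lt_of_limsup_lt hc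
    (isBoundedUnder_of_eventually_le (hC.mono fun p hp => (abs_le.1 hp).2))
  obtain ⟨P, hP, Q, hQ, hPQ⟩ := eventually_prod_iff.1 hlt
  filter_upwards [eventually_eventually_nhds.2 hP] with y hy
  obtain ⟨D, hD⟩ := hf.eventually_abs_quotient_le y h
  refine limsup_le_of_le (isBoundedUnder_of_eventually_ge
    (hD.mono fun p hp => (abs_le.1 hp).1)).isCoboundedUnder_le ?_
  filter_upwards [hy.prod_mk hQ] with p hp
  exact (hPQ hp.1 hp.2).le

/-- Proposition 2.1(5): as `ε_k → 0`, `f⁰_{ε_k}(x;h) → f⁰(x;h)` and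
`⋂ k, ∂^{ε_k} f(x) = ∂f(x)`. -/
theorem epsDeriv_tendsto_clarkeDeriv_and_iInter_epsGrad
    (f : X → ℝ) (hf : LocallyLipschitz f) (x : X)
    (εs : ℕ → ℝ) (hεs : ∀ k, 0 < εs k) (hlim : Tendsto εs atTop (𝓝 0)) :
    (∀ h : X, Tendsto (fun k => epsDeriv f (εs k) x h) atTop (𝓝 (clarkeDeriv f x h))) ∧
    (⋂ k, epsGrad f (εs k) x) = clarkeGrad f x := by
  have hx : ∀ k, x ∈ closedBall x (εs k) := fun k => mem_closedBall_self (hεs k).le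
  have key : ∀ h c, clarkeDeriv f x h < c →
      ∀ᶠ k in atTop, ∀ y ∈ closedBall x (εs k), clarkeDeriv f y h ≤ c := by
    intro h c hc
    obtain ⟨δ, hδ, hball⟩ := Metric.eventually_nhds_iff.1 (hf.eventually_clarkeDeriv_le hc)
    filter_upwards [hlim.eventually_lt_const hδ] with k hk y hy
    exact hball (lt_of_le_of_lt hy hk)
  refine ⟨fun h => ?_, Subset.antisymm (fun a ha h => ?_) fun a ha => ?_⟩
  · refine tendsto_order.2 ⟨fun b hb => ?_, fun b hb => ?_⟩
    · filter_upwards [key h _ (lt_add_one _)] with k hk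
      exact hb.trans_le (le_csSup ⟨_, forall_mem_image.2 hk⟩ (mem_image_of_mem _ (hx k)))
    · obtain ⟨c, hc, hcb⟩ := exists_between hb
      filter_upwards [key h c hc] with k hk
      exact (csSup_le ⟨_, mem_image_of_mem _ (hx k)⟩ (forall_mem_image.2 hk)).trans_lt hcb
  · refine le_of_forall_gt_imp_ge_of_dense fun c hc => ?_
    obtain ⟨k, hk⟩ := (key h c hc).exists
    have hsub : epsGrad f (εs k) x ⊆ {b : X | ⟪b, h⟫ ≤ c} := by
      refine closure_minimal (convexHull_min (iUnion₂_subset fun y hy b hb => ?_) ?_)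
        (isClosed_le (by fun_prop) continuous_const)
      · exact (hb h).trans (hk y hy)
      · simp only [real_inner_comm h]
        exact convex_halfSpace_le (innerSL ℝ h).isLinear c
    exact hsub (mem_iInter.1 ha k)
  · exact mem_iInter.2 fun k =>
      subset_closure (subset_convexHull ℝ _ (mem_iUnion₂.2 ⟨x, hx k, ha⟩))
end
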